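/- Fix natural numbers N ≥ 1, T ≥ 1, n ≥ 1, a terminal reward r : EuclideanSpace ℝ (Fin n) → ℝ, a real parameter α, and a feasible set S of trajectory profiles x : Fin N → Fin (T+1) → EuclideanSpace ℝ (Fin n). Define J_i(x) = −r(x_i(T)) + α · Σ_{t=0}^{T−1} Σ_{j ≠ i} dist(x_i(t), x_j(t))² and P(x) = −Σ_{i=0}^{N−1} r(x_i(T)) + α · Σ_{t=0}^{T−1} Σ_{i < j} dist(x_i(t), x_j(t))². If x* ∈ S minimizes P over S, then x* is a generalized Nash equilibrium of the racing game: for every agent i and every alternative trajectory y : Fin (T+1) → EuclideanSpace ℝ (Fin n) such that the profile obtained from x* by replacing the i-th agent's trajectory with y lies in S, one has J_i(x*) ≤ J_i(x* with i-th trajectory replaced by y). -/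

import Mathlib

open Finset

/-- The racing cost of agent `i`:
`J_i(x) = -r(x_i(T)) + α ⬝ Σ_{t=0}^{T-1} Σ_{j ≠ i} dist(x_i(t), x_j(t))²`. -/
noncomputable def racingCost (N T n : ℕ) (r : EuclideanSpace ℝ (Fin n) → ℝ) (α : ℝ)
    (i : Fin N) (x : Fin N → Fin (T + 1) → EuclideanSpace ℝ (Fin n)) : ℝ :=
  -r (x i (Fin.last T)) +
    α * ∑ t : Fin T, ∑ j ∈ univ.filter (fun j => j ≠ i),
      dist (x i t.castSucc) (x j t.castSucc) ^ 2

/-- The racing potential: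
`P(x) = -Σ_i r(x_i(T)) + α ⬝ Σ_{t=0}^{T-1} Σ_{i < j} dist(x_i(t), x_j(t))²`. -/
noncomputable def racingPotential (N T n : ℕ) (r : EuclideanSpace ℝ (Fin n) → ℝ) (α : ℝ)
    (x : Fin N → Fin (T + 1) → EuclideanSpace ℝ (Fin n)) : ℝ :=
  -∑ i : Fin N, r (x i (Fin.last T)) +
    α * ∑ t : Fin T, ∑ i : Fin N, ∑ j ∈ univ.filter (fun j => i < j),
      dist (x i t.castSucc) (x j t.castSucc) ^ 2

/-- Splitting a sum over pairs `a < b` into pairs containing `i` and the rest. -/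
lemma pair_sum_split {N : ℕ} (d : Fin N → Fin N → ℝ) (hd : ∀ a b, d a b = d b a) (i : Fin N) :
    ∑ a : Fin N, ∑ b ∈ univ.filter (fun b => a < b), d a b =
      ∑ j ∈ univ.filter (fun j => j ≠ i), d i j +
      ∑ a : Fin N, ∑ b : Fin N, (if a < b ∧ a ≠ i ∧ b ≠ i then d a b else 0) := by
  have h1 : ∀ a b : Fin N, (if a < b then d a b else 0) =
      (if a = i then (if i < b then d i b else 0) else 0) +
      (if b = i then (if a < i then d i a else 0) else 0) +
      (if a < b ∧ a ≠ i ∧ b ≠ i then d a b else 0) := by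
    intro a b
    by_cases ha : a = i
    · subst ha
      by_cases hb : b = a
      · subst hb; simp
      · simp [hb]
    · by_cases hb : b = i
      · subst hb; simp [ha, hd a b]
      · simp [ha, hb]
  simp only [sum_filter]
  rw [sum_congr rfl fun a _ => sum_congr rfl fun b _ => h1 a b]
  simp only [sum_add_distrib]
  congr 1
  rw [sum_comm]
  simp only [sum_ite_eq', mem_univ, if_true]
  rw [← sum_add_distrib]
  refine sum_congr rfl fun j _ => ?_
  rcases lt_trichotomy i j with h | h | h
  · simp [h, h.ne', h.not_gt]
  · simp [h]
  · simp [h, h.ne, h.not_gt]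

/-- A minimizer of the racing potential over the feasible set `S` is a
generalized Nash equilibrium of the racing game. -/
theorem racingPotential_minimizer_is_generalized_nash_equilibrium
    (N T n : ℕ) (hN : 1 ≤ N) (hT : 1 ≤ T) (hn : 1 ≤ n)
    (r : EuclideanSpace ℝ (Fin n) → ℝ) (α : ℝ)
    (S : Set (Fin N → Fin (T + 1) → EuclideanSpace ℝ (Fin n)))
    (xstar : Fin N → Fin (T + 1) → EuclideanSpace ℝ (Fin n))
    (hmem : xstar ∈ S)
    (hmin : ∀ x ∈ S, racingPotential N T n r α xstar ≤ racingPotential N T n r α x) :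
    ∀ (i : Fin N) (y : Fin (T + 1) → EuclideanSpace ℝ (Fin n)),
      Function.update xstar i y ∈ S →
        racingCost N T n r α i xstar ≤
          racingCost N T n r α i (Function.update xstar i y) := by
  intro i y hy
  have h := hmin _ hy
  set z := Function.update xstar i y with hz
  have hzj : ∀ j, j ≠ i → z j = xstar j := fun j hj => by simp [hz, hj]
  unfold racingPotential at h
  unfold racingCost
  have e : ∀ (x : Fin N → Fin (T + 1) → EuclideanSpace ℝ (Fin n)) (t : Fin T), _ :=
    fun x t => pair_sum_split (fun a b => dist (x a t.castSucc) (x b t.castSucc) ^ 2)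
      (fun a b => by simp only [dist_comm]) i
  simp only [e, sum_add_distrib, mul_add] at h
  rw [← add_sum_erase univ (fun k => r (xstar k (Fin.last T))) (mem_univ i),
    ← add_sum_erase univ (fun k => r (z k (Fin.last T))) (mem_univ i)] at h
  have h2 : ∑ k ∈ univ.erase i, r (z k (Fin.last T)) =
      ∑ k ∈ univ.erase i, r (xstar k (Fin.last T)) :=
    sum_congr rfl fun k hk => by rw [hzj k (ne_of_mem_erase hk)]
  have h3 : (∑ t : Fin T, ∑ a : Fin N, ∑ b : Fin N, (if a < b ∧ a ≠ i ∧ b ≠ i then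
        dist (z a t.castSucc) (z b t.castSucc) ^ 2 else 0)) =
      ∑ t : Fin T, ∑ a : Fin N, ∑ b : Fin N, (if a < b ∧ a ≠ i ∧ b ≠ i then
        dist (xstar a t.castSucc) (xstar b t.castSucc) ^ 2 else 0) := by
    refine sum_congr rfl fun t _ => sum_congr rfl fun a _ => sum_congr rfl fun b _ => ?_
    split_ifs with hc
    · rw [hzj a hc.2.1, hzj b hc.2.2]
    · rfl
  rw [h2, h3] at h
  linarith
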